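/- arXiv:1708.06280 — 2 statements merged into one kernel-verified Lean document; each statement's English description precedes it below -/
import Mathlib

section
/- Let F be an algebraically closed field of characteristic zero and A ∈ GL_n(F). Then there exists an invertible diagonal matrix D over F such that A * D has n distinct eigenvalues, i.e. the characteristic polynomial of A*D is separable. -/
open Polynomial in
/-- Separability is an open condition on a pencil `a + t c` through a separable polynomial `a`,
provided `c` vanishes at some point where `a` does not. -/
theorem Polynomial.Separable.finite_not_separable_add_C_mul {F : Type*} [Field F] [IsAlgClosed F]
    [CharZero F] {a c : F[X]} (ha : a.Separable) {x : F} (hax : a.eval x ≠ 0)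
    (hcx : c.eval x = 0) : {t : F | ¬ (a + C t * c).Separable}.Finite := by
  classical
  by_cases hW : derivative a * c - a * derivative c = 0
  · have hdvd : a ∣ c :=
      (show IsCoprime a (derivative a) from ha).dvd_of_dvd_mul_left
        ⟨derivative c, sub_eq_zero.mp hW⟩
    obtain ⟨k, rfl⟩ := hdvd
    have hk : derivative k = 0 := by
      have h : a * a * derivative k = 0 := by
        rw [derivative_mul] at hW
        linear_combination -hW
      exact (mul_eq_zero.mp h).resolve_left (mul_self_ne_zero.mpr ha.ne_zero)
    rw [eq_C_of_derivative_eq_zero hk] at hcx ⊢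
    have hk0 : k.coeff 0 = 0 := by simpa [hax] using hcx
    simp [hk0, ha]
  · refine ((derivative a * c - a * derivative c).roots.toFinset.finite_toSet.biUnion
      (t := fun r => {t : F | (a + C t * c).eval r = 0 ∧ (derivative (a + C t * c)).eval r = 0})
      fun r _ => Set.Subsingleton.finite ?_).subset fun t ht => ?_
    · rintro s ⟨hs, hs'⟩ t ⟨ht, ht'⟩
      simp only [eval_add, eval_mul, eval_C, derivative_add, derivative_C_mul] at hs hs' ht ht'
      by_contra hst
      have hc : c.eval r = 0 := (mul_eq_zero.mp
        (show (s - t) * c.eval r = 0 by linear_combination hs - ht)).resolve_left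
          (sub_ne_zero.mpr hst)
      have hc' : (derivative c).eval r = 0 := (mul_eq_zero.mp
        (show (s - t) * (derivative c).eval r = 0 by linear_combination hs' - ht')).resolve_left
          (sub_ne_zero.mpr hst)
      have := (isCoprime_iff_aeval_ne_zero_of_isAlgClosed F F a (derivative a)).mp ha r
      simp_all
    · have h : ¬ IsCoprime (a + C t * c) (derivative (a + C t * c)) := ht
      rw [isCoprime_iff_aeval_ne_zero_of_isAlgClosed F F] at h
      push Not at h
      obtain ⟨r, hr, hr'⟩ := h
      rw [coe_aeval_eq_eval] at hr hr'
      refine Set.mem_biUnion (x := r) ?_ ⟨hr, hr'⟩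
      simp only [eval_add, eval_mul, eval_C, derivative_add, derivative_C_mul] at hr hr'
      simp only [Finset.mem_coe, Multiset.mem_toFinset, mem_roots hW, IsRoot, eval_sub, eval_mul]
      linear_combination c.eval r * hr' - (derivative c).eval r * hr

open Polynomial in
theorem Polynomial.squarefree_of_squarefree_reverse {F : Type*} [Field F] {p : F[X]}
    (h0 : p.coeff 0 ≠ 0) (h : Squarefree p.reverse) : Squarefree p := by
  rintro q ⟨k, rfl⟩
  have hq0 : q.coeff 0 ≠ 0 := by
    rintro hq
    simp [mul_coeff_zero, hq] at h0
  have hu : IsUnit q.reverse := h _ ⟨k.reverse, by simp only [reverse_mul_of_domain]⟩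
  have hq : q.natDegree = 0 := by
    rw [natDegree_eq_reverse_natDegree_add_natTrailingDegree, natDegree_eq_zero_of_isUnit hu,
      natTrailingDegree_eq_zero.mpr (Or.inr hq0)]
  rw [eq_C_of_natDegree_eq_zero hq, isUnit_C]
  exact hq0.isUnit

open Polynomial in
theorem Matrix.exists_charpolyRev_mul_diagonal_add_single {R n : Type*} [CommRing R] [Fintype n]
    [DecidableEq n] (A : Matrix n n R) (d : n → R) (j : n) :
    ∃ c : R[X], ∀ t : R, (A * diagonal (d + Pi.single j t)).charpolyRev =
      (A * diagonal d).charpolyRev + C t * c := by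
  let N : Matrix n n R[X] := 1 - (X : R[X]) • (A * diagonal d).map C
  refine ⟨(N.updateCol j fun i => -X * C (A i j)).det, fun t => ?_⟩
  have h : 1 - (X : R[X]) • (A * diagonal (d + Pi.single j t)).map C =
      N.updateCol j ((fun i => N i j) + C t • fun i => -X * C (A i j)) := by
    ext1 i k
    by_cases hk : k = j
    · subst hk
      simp [N, mul_diagonal]
      ring
    · simp [N, mul_diagonal, hk]
  rw [charpolyRev, h, det_updateCol_add, det_updateCol_smul, updateCol_eq_self]
  rfl

theorem Matrix.exists_separable_charpolyRev_mul_diagonal {F n : Type*} [Field F] [IsAlgClosed F]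
    [CharZero F] [Fintype n] [DecidableEq n] (A : Matrix n n F) :
    ∃ d : n → F, (∀ i, d i ≠ 0) ∧ (A * diagonal d).charpolyRev.Separable := by
  suffices h : ∀ s : Finset n, ∃ d : n → F, (∀ i ∈ s, d i ≠ 0) ∧
      (A * diagonal d).charpolyRev.Separable by
    simpa using h Finset.univ
  intro s
  induction s using Finset.induction_on with
  | empty => exact ⟨0, by simp, by simp [charpolyRev, Polynomial.separable_one]⟩
  | insert j s hj ih =>
    obtain ⟨d, hd, hsep⟩ := ih
    obtain ⟨c, hc⟩ := exists_charpolyRev_mul_diagonal_add_single A d j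
    have hc0 : c.eval 0 = 0 := by
      simpa using congrArg (Polynomial.eval 0) (hc 1)
    obtain ⟨t, ht⟩ := ((hsep.finite_not_separable_add_C_mul (x := 0) (by simp) hc0).insert
      (-d j)).exists_notMem
    simp only [Set.mem_insert_iff, Set.mem_ofPred_eq, not_or, not_not] at ht
    refine ⟨d + Pi.single j t, fun i hi => ?_, by rw [hc t]; exact ht.2⟩
    obtain rfl | hi := Finset.mem_insert.mp hi
    · simpa [add_comm, add_eq_zero_iff_eq_neg] using ht.1
    · simpa [ne_of_mem_of_not_mem hi hj] using hd i hi

theorem exists_diag_mul_separable_charpoly (F : Type*) [Field F] [IsAlgClosed F]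
    [CharZero F] (n : ℕ) (A : GL (Fin n) F) :
    ∃ D : Matrix (Fin n) (Fin n) F, D.IsDiag ∧ IsUnit D ∧
      (Matrix.charpoly ((A : Matrix (Fin n) (Fin n) F) * D)).Separable := by
  obtain ⟨d, hd, hsep⟩ :=
    Matrix.exists_separable_charpolyRev_mul_diagonal (A : Matrix (Fin n) (Fin n) F)
  have hD : IsUnit (Matrix.diagonal d) :=
    Matrix.isUnit_diagonal.mpr (Pi.isUnit_iff.mpr fun i => (hd i).isUnit)
  refine ⟨Matrix.diagonal d, Matrix.isDiag_diagonal d, hD, ?_⟩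
  rw [PerfectField.separable_iff_squarefree]
  refine Polynomial.squarefree_of_squarefree_reverse (fun h0 => ?_) ?_
  · have hdet := (Matrix.isUnit_iff_isUnit_det _).mp (A.isUnit.mul hD)
    rw [Matrix.det_eq_sign_charpoly_coeff, h0, mul_zero] at hdet
    exact not_isUnit_zero hdet
  · rw [Matrix.reverse_charpoly]
    exact hsep.squarefree
end

section
/- Let ψ be an automorphism of an algebraically closed field F of characteristic zero inducing entrywise an automorphism φ of GL_n(F), and suppose every invertible diagonal matrix lies in the twisted conjugacy class [I_n]_φ = {X * φ(X)⁻¹ : X ∈ GL_n(F)}. Then every matrix in GL_n(F) is a product of at most 3 matrices from [I_n]_φ ∪ [I_n]_φ⁻¹, where [I_n]_φ⁻¹ = {M⁻¹ : M ∈ [I_n]_φ}. -/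
open Polynomial in
theorem dvd_and_dvd_of_dvd_pencil {F : Type*} [Field F] {m p q : F[X]} {s t : F} (hst : s ≠ t)
    (hs : m ∣ p + C s * q) (ht : m ∣ p + C t * q) : m ∣ p ∧ m ∣ q := by
  have hq : m ∣ q := by
    have h : m ∣ C (s - t) * q := by
      have := dvd_sub hs ht
      rwa [add_sub_add_left_eq_sub, ← sub_mul, ← C_sub] at this
    have hu : IsUnit (C (s - t)) := isUnit_C.2 (sub_ne_zero.2 hst).isUnit
    exact hu.dvd_mul_left.1 h
  exact ⟨(dvd_add_left (hq.mul_left _)).1 hs, hq⟩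

open Polynomial in
theorem eq_zero_of_mul_derivative_eq {F : Type*} [Field F] [CharZero F] {p q : F[X]}
    (hp : p.Monic) (hdeg : q.degree < p.degree) (h : p * derivative q = derivative p * q) :
    q = 0 := by
  by_contra hq
  have hl := congrArg leadingCoeff h
  rw [leadingCoeff_mul, leadingCoeff_mul, leadingCoeff_derivative, leadingCoeff_derivative,
    hp.leadingCoeff, one_mul, one_mul, mul_comm] at hl
  have hn := Nat.cast_injective (mul_right_cancel₀ (leadingCoeff_ne_zero.2 hq) hl)
  exact (natDegree_lt_natDegree hq hdeg).ne hn

open Polynomial in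
/-- In a nonconstant pencil, the multiple roots of a generic member are the common ones. -/
theorem finite_setOf_exists_moving_multiple_root {F : Type*} [Field F] [CharZero F] {p q : F[X]}
    (hp : p.Monic) (hdeg : q.degree < p.degree) :
    {t : F | ∃ r, (X - C r) ^ 2 ∣ p + C t * q ∧
      ¬((X - C r) ^ 2 ∣ p ∧ (X - C r) ^ 2 ∣ q)}.Finite := by
  by_cases hw : p * derivative q - derivative p * q = 0
  · have hq := eq_zero_of_mul_derivative_eq hp hdeg (sub_eq_zero.1 hw)
    convert Set.finite_empty
    refine Set.eq_empty_of_forall_notMem ?_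
    rintro t ⟨r, h1, h2⟩
    simp [hq] at h1 h2
    exact h2 h1
  · have hfin : {r : F | (p * derivative q - derivative p * q).IsRoot r}.Finite :=
      finite_setOfPred_isRoot hw
    refine (hfin.biUnion (t := fun r => {t : F | (X - C r) ^ 2 ∣ p + C t * q ∧
      ¬((X - C r) ^ 2 ∣ p ∧ (X - C r) ^ 2 ∣ q)}) fun r _ => ?_).subset ?_
    · refine Set.Subsingleton.finite ?_
      rintro s ⟨hs, hn⟩ t ⟨ht, -⟩
      by_contra hst
      exact hn (dvd_and_dvd_of_dvd_pencil hst hs ht)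
    · rintro t ⟨r, h, hn⟩
      refine Set.mem_biUnion ?_ ⟨h, hn⟩
      obtain ⟨g, hg⟩ := h
      have h0 := congrArg (eval r) hg
      have h1 := congrArg (fun x => eval r (derivative x)) hg
      simp [derivative_mul, derivative_pow] at h0 h1
      simp only [Set.mem_ofPred_eq, IsRoot.def, eval_sub, eval_mul]
      linear_combination h0 * eval r (derivative q) - h1 * eval r q

open Polynomial Matrix in
theorem charpoly_mul_diagonal_update {F ι : Type*} [Field F] [Fintype ι] [DecidableEq ι]
    (A : Matrix ι ι F) (d : ι → F) (i : ι) (t : F) :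
    (A * diagonal (Function.update d i t)).charpoly =
      (A * diagonal (Function.update d i 0)).charpoly +
        C t * ((A * diagonal (Function.update d i 1)).charpoly -
          (A * diagonal (Function.update d i 0)).charpoly) := by
  have key : ∀ s : F, (A * diagonal (Function.update d i s)).charpoly =
      ((charmatrix (A * diagonal d)).updateCol i (Pi.single i X)).det +
        C s * ((charmatrix (A * diagonal d)).updateCol i (fun k => -C (A k i))).det := by
    intro s
    rw [← det_updateCol_smul, ← det_updateCol_add, Matrix.charpoly]
    congr 1
    ext1 k l
    by_cases hl : l = i
    · subst hl
      by_cases hk : k = l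
      · subst hk
        simp [mul_diagonal, mul_comm]
        ring
      · simp [mul_diagonal, mul_comm, hk]
    · simp [charmatrix_apply, mul_diagonal, hl]
  rw [key t, key 0, key 1]
  simp

open Polynomial Matrix in
/-- Every invertible matrix has a product with an invertible diagonal matrix without multiple
eigenvalues. -/
theorem exists_diagonal_charpoly_no_multiple_root {F ι : Type*} [Field F] [CharZero F] [Fintype ι]
    [DecidableEq ι] (A : Matrix ι ι F) (hA : A.det ≠ 0) :
    ∃ d : ι → F, (∀ i, d i ≠ 0) ∧ ∀ r, ¬(X - C r) ^ 2 ∣ (A * diagonal d).charpoly := by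
  set f : (ι → F) → F[X] := fun d => (A * diagonal d).charpoly with hf
  let M : (ι → F) → Set F := fun d => {r | (X - C r) ^ 2 ∣ f d}
  have hmonic : ∀ d, (f d).Monic := fun d => charpoly_monic _
  have hMfin : ∀ d, (M d).Finite := fun d =>
    (finite_setOfPred_isRoot (hmonic d).ne_zero).subset fun r hr =>
      dvd_iff_isRoot.1 ((dvd_pow_self _ two_ne_zero).trans hr)
  have haff : ∀ d i t, f (Function.update d i t) = f (Function.update d i 0) +
      C t * (f (Function.update d i 1) - f (Function.update d i 0)) :=
    charpoly_mul_diagonal_update A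
  have hgen : ∀ d i, {t : F | ¬ M (Function.update d i t) ⊆ M d}.Finite := by
    intro d i
    have hdeg : (f (Function.update d i 1) - f (Function.update d i 0)).degree <
        (f (Function.update d i 0)).degree := by
      have he : (f (Function.update d i 1)).degree = (f (Function.update d i 0)).degree := by
        simp [hf, charpoly_degree_eq_dim]
      rw [← he]
      exact degree_sub_lt_left he (hmonic _).ne_zero
        ((hmonic _).leadingCoeff.trans (hmonic _).leadingCoeff.symm)
    refine (finite_setOf_exists_moving_multiple_root (hmonic _) hdeg).subset ?_
    intro t ht
    obtain ⟨r, hr, hn⟩ := Set.not_subset.1 ht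
    refine ⟨r, haff d i t ▸ hr, fun ⟨h0, h1⟩ => hn ?_⟩
    have := haff d i (d i)
    rw [Function.update_eq_self] at this
    change _ ∣ f d
    rw [this]
    exact dvd_add h0 (h1.mul_left _)
  let P : (ι → F) → Prop := fun d => (∀ i, d i ≠ 0) ∧
    ∀ e : ι → F, (∀ i, e i ≠ 0) → (M d).ncard ≤ (M e).ncard
  have hP : ∃ d, P d := by
    let S := {d : ι → F // ∀ i, d i ≠ 0}
    have : Nonempty S := ⟨⟨1, fun _ => one_ne_zero⟩⟩
    let g : S → ℕ := fun d => (M d.1).ncard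
    exact ⟨(Function.argmin g).1, (Function.argmin g).2,
      fun e he => Function.argmin_le g (⟨e, he⟩ : S)⟩
  have hprop : ∀ (s : Finset ι) (d d' : ι → F) (r : F), P d → r ∈ M d →
      (∀ j ∉ s, d' j = d j) → r ∈ M d' := by
    intro s
    induction s using Finset.induction_on with
    | empty =>
      intro d d' r _ hr h
      rwa [show d' = d from funext fun j => h j (Finset.notMem_empty j)]
    | insert i s _ ih =>
      intro d d' r hd hr h
      have hinf := ((hgen d i).union (Set.finite_singleton 0)).infinite_compl
      have hmem : ∀ t ∈ ({t : F | ¬ M (Function.update d i t) ⊆ M d} ∪ {0})ᶜ,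
          r ∈ M (Function.update d' i t) := by
        intro t ht
        simp only [Set.mem_compl_iff, Set.mem_union, Set.mem_ofPred_eq, Set.mem_singleton_iff,
          not_or, not_not] at ht
        obtain ⟨hsub, ht0⟩ := ht
        have hne : ∀ j, Function.update d i t j ≠ 0 := by
          intro j
          by_cases hj : j = i
          · subst hj; simpa
          · simpa [hj] using hd.1 j
        have heq : M (Function.update d i t) = M d :=
          Set.eq_of_subset_of_ncard_le hsub (hd.2 _ hne) (hMfin d)
        refine ih (Function.update d i t) _ r ⟨hne, heq ▸ hd.2⟩ (heq ▸ hr) fun j hj => ?_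
        by_cases hji : j = i
        · subst hji; simp
        · simpa [hji] using h j (by simp [hji, hj])
      obtain ⟨a, ha, b, hb, hab⟩ := hinf.nontrivial
      obtain ⟨h0, h1⟩ := dvd_and_dvd_of_dvd_pencil (m := (X - C r) ^ 2) hab
        ((hmem a ha).trans (haff d' i a).dvd) ((hmem b hb).trans (haff d' i b).dvd)
      have := haff d' i (d' i)
      rw [Function.update_eq_self] at this
      change _ ∣ f d'
      rw [this]
      exact dvd_add h0 (h1.mul_left _)
  obtain ⟨d, hd⟩ := hP
  refine ⟨d, hd.1, fun r hr => hA ?_⟩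
  have hall : ∀ d', (X - C r) ∣ f d' := fun d' => (dvd_pow_self _ two_ne_zero).trans
    (hprop Finset.univ d d' r hd hr fun j hj => absurd (Finset.mem_univ j) hj)
  have hr0 : r = 0 := by
    have h0 := dvd_iff_isRoot.1 (hall 0)
    simp only [hf, diagonal_zero', mul_zero, charpoly_zero, IsRoot.def, eval_pow, eval_X] at h0
    exact eq_zero_of_pow_eq_zero h0
  have h1 := dvd_iff_isRoot.1 (hall 1)
  simp only [hf, diagonal_one', mul_one, IsRoot.def, hr0] at h1
  rw [det_eq_sign_charpoly_coeff, coeff_zero_eq_eval_zero, h1, mul_zero]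

open Polynomial Matrix in
theorem exists_diagonalization_of_no_multiple_root {F ι : Type*} [Field F] [IsAlgClosed F]
    [Fintype ι] [DecidableEq ι] (B : Matrix ι ι F)
    (hB : ∀ r, ¬(X - C r) ^ 2 ∣ B.charpoly) :
    ∃ (P : GL ι F) (e : ι → F), B * (P : Matrix ι ι F) = (P : Matrix ι ι F) * diagonal e := by
  classical
  have hne : B.charpoly ≠ 0 := (charpoly_monic B).ne_zero
  have hnodup : B.charpoly.roots.Nodup := Multiset.nodup_iff_count_le_one.2 fun r => by
    rw [count_roots, rootMultiplicity_le_iff hne]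
    exact hB r
  have hcard : B.charpoly.roots.toFinset.card = Fintype.card ι := by
    rw [Multiset.toFinset_card_of_nodup hnodup, IsAlgClosed.card_roots_eq_natDegree,
      charpoly_natDegree_eq_dim]
  let σ : ι ≃ B.charpoly.roots.toFinset := Fintype.equivOfCardEq (by simpa using hcard.symm)
  let e : ι → F := fun i => σ i
  have he : Function.Injective e := Subtype.val_injective.comp σ.injective
  have hex : ∀ i, ∃ v : ι → F, v ≠ 0 ∧ (scalar ι (e i) - B) *ᵥ v = 0 := fun i => by
    rw [exists_mulVec_eq_zero_iff, ← eval_charpoly]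
    exact isRoot_of_mem_roots (Multiset.mem_toFinset.1 (σ i).2)
  choose v hv0 hv using hex
  have hBv : ∀ i, B *ᵥ v i = e i • v i := fun i => by
    have := hv i
    rw [sub_mulVec, sub_eq_zero] at this
    rw [← this, scalar_apply, ← smul_one_eq_diagonal, smul_mulVec, one_mulVec]
  have hli : LinearIndependent F v :=
    Module.End.eigenvectors_linearIndependent' (toLin' B) e he v fun i =>
      Module.End.hasEigenvector_iff.2
        ⟨Module.End.mem_eigenspace_iff.2 (by simpa using hBv i), hv0 i⟩
  have hu : IsUnit (of v)ᵀ := linearIndependent_cols_iff_isUnit.1 hli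
  refine ⟨hu.unit, e, ?_⟩
  ext k i
  have := congrFun (hBv i) k
  rw [mul_diagonal]
  simpa [mul_apply, mulVec, dotProduct, mul_comm] using this


theorem product_of_three_twisted (F : Type*) [Field F] [IsAlgClosed F] [CharZero F]
    (n : ℕ) (ψ : F ≃+* F)
    (φ : GL (Fin n) F →* GL (Fin n) F)
    (hφ : ∀ X : GL (Fin n) F,
      (φ X : Matrix (Fin n) (Fin n) F) = (X : Matrix (Fin n) (Fin n) F).map ψ)
    (hdiag : ∀ D : GL (Fin n) F, (D : Matrix (Fin n) (Fin n) F).IsDiag →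
      D ∈ {M : GL (Fin n) F | ∃ X, M = X * (φ X)⁻¹}) :
    ∀ A : GL (Fin n) F, ∃ l : List (GL (Fin n) F), l.length ≤ 3 ∧
      (∀ m ∈ l, m ∈ {M : GL (Fin n) F | ∃ X, M = X * (φ X)⁻¹} ∪
        {M : GL (Fin n) F | ∃ X, M = X * (φ X)⁻¹}⁻¹) ∧
      l.prod = A := by
  intro A
  obtain ⟨d, hd0, hd⟩ := exists_diagonal_charpoly_no_multiple_root
    (A : Matrix (Fin n) (Fin n) F) ((Matrix.isUnit_iff_isUnit_det _).1 A.isUnit).ne_zero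
  obtain ⟨P, e, hP⟩ := exists_diagonalization_of_no_multiple_root _ hd
  have hDu : IsUnit (Matrix.diagonal d) := by
    rw [Matrix.isUnit_diagonal, Pi.isUnit_iff]
    exact fun i => (hd0 i).isUnit
  let D : GL (Fin n) F := hDu.unit
  let E : GL (Fin n) F := P⁻¹ * (A * D) * P
  have hE : (E : Matrix (Fin n) (Fin n) F) = Matrix.diagonal e := by
    change ((P⁻¹ : GL (Fin n) F) : Matrix (Fin n) (Fin n) F) *
      ((A : Matrix (Fin n) (Fin n) F) * Matrix.diagonal d) * (P : Matrix (Fin n) (Fin n) F) = _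
    rw [mul_assoc, hP, ← mul_assoc, Units.inv_mul, one_mul]
  obtain ⟨Y, hY⟩ := hdiag E (hE ▸ Matrix.isDiag_diagonal e)
  obtain ⟨Z, hZ⟩ := hdiag D (Matrix.isDiag_diagonal d)
  refine ⟨[(P * Y) * (φ (P * Y))⁻¹, (P * (φ P)⁻¹)⁻¹, D⁻¹], le_rfl, ?_, ?_⟩
  · intro m hm
    simp only [List.mem_cons, List.not_mem_nil, or_false] at hm
    rcases hm with rfl | rfl | rfl
    · exact Or.inl ⟨_, rfl⟩
    · exact Or.inr ⟨P, inv_inv _⟩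
    · exact Or.inr ⟨Z, (inv_inv D).trans hZ⟩
  · have hAE : A = P * E * P⁻¹ * D⁻¹ := by simp only [E]; group
    rw [hAE, hY]
    simp only [List.prod_cons, List.prod_nil, map_mul]
    group
end
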